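/- arXiv:nlin/0306058 — 2 statements merged into one kernel-verified Lean document; each statement's English description precedes it below -/
import Mathlib

section
/- Let F₀, s : ℝ² → ℝ be real analytic. Then, as H → 0 within the slit plane P, the 2×2 matrix product diag(ln|H|, (ln|H|)²/(2π)) · Dω(H) · [[H₂, −H₁], [−H₁, −H₂]] converges (entrywise) to ∂F₀/∂H₂(0) times the 2×2 identity matrix. -/
open Real Filter Topology MeasureTheory

/-- The Euclidean norm `|H| = √(H₁² + H₂²)` on `ℝ²`. -/
noncomputable def nrm (H : ℝ × ℝ) : ℝ := Real.sqrt (H.1 ^ 2 + H.2 ^ 2)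

/-- The slit plane `P = ℝ² \ {(t,0) : t ≥ 0}`. -/
def slitP : Set (ℝ × ℝ) := {H | ¬ (0 ≤ H.1 ∧ H.2 = 0)}

/-- The branch of the polar angle with values in `(0, 2π)` on the slit plane:
`argS (r cos θ, r sin θ) = θ` for `r > 0`, `θ ∈ (0, 2π)`. -/
noncomputable def argS (H : ℝ × ℝ) : ℝ :=
  Real.pi + Complex.arg (-(H.1 + H.2 * Complex.I))

/-- The partial derivative with respect to the first variable. -/
noncomputable def pd₁ (f : ℝ × ℝ → ℝ) (H : ℝ × ℝ) : ℝ := fderiv ℝ f H (1, 0)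

/-- The partial derivative with respect to the second variable. -/
noncomputable def pd₂ (f : ℝ × ℝ → ℝ) (H : ℝ × ℝ) : ℝ := fderiv ℝ f H (0, 1)

/-- `D(H) = (1/(2π))(ln|H| + 1) + ∂s/∂H₂(H)`. -/
noncomputable def Dfun (s : ℝ × ℝ → ℝ) (H : ℝ × ℝ) : ℝ :=
  (1 / (2 * Real.pi)) * (Real.log (nrm H) + 1) + pd₂ s H

/-- First component of the frequency map. -/
noncomputable def ω₁ (F₀ s : ℝ × ℝ → ℝ) (H : ℝ × ℝ) : ℝ :=
  pd₁ F₀ H - pd₂ F₀ H * ((1 / (2 * Real.pi)) * argS H + pd₁ s H) / Dfun s H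

/-- Second component of the frequency map. -/
noncomputable def ω₂ (F₀ s : ℝ × ℝ → ℝ) (H : ℝ × ℝ) : ℝ :=
  pd₂ F₀ H / Dfun s H

/-- The Jacobian matrix `Dω(H)` of the frequency map, with entries `∂ωᵢ/∂Hⱼ(H)`. -/
noncomputable def Dω (F₀ s : ℝ × ℝ → ℝ) (H : ℝ × ℝ) : Matrix (Fin 2) (Fin 2) ℝ :=
  !![pd₁ (ω₁ F₀ s) H, pd₂ (ω₁ F₀ s) H;
     pd₁ (ω₂ F₀ s) H, pd₂ (ω₂ F₀ s) H]


lemma clog_hasFDerivAt (H : ℝ × ℝ) (hH : H ∈ slitP) :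
    ∃ G : ℝ × ℝ →L[ℝ] ℂ,
      HasFDerivAt (fun H : ℝ × ℝ => Complex.log (-((H.1 : ℂ) + H.2 * Complex.I))) G H ∧
      ∀ v : ℝ × ℝ, G v = (v.1 + v.2 * Complex.I) / ((H.1 : ℂ) + H.2 * Complex.I) := by
  have hz : -((H.1 : ℂ) + H.2 * Complex.I) ∈ Complex.slitPlane := by
    rw [Complex.mem_slitPlane_iff]
    simp only [slitP, Set.mem_ofPred_eq, not_and] at hH
    by_cases h : 0 ≤ H.1
    · right; simpa using hH h
    · left; simpa using h
  have h1 : HasFDerivAt (fun H : ℝ × ℝ => ((H.1 : ℝ) : ℂ))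
      (Complex.ofRealCLM.comp (ContinuousLinearMap.fst ℝ ℝ ℝ)) H :=
    (Complex.ofRealCLM.comp (ContinuousLinearMap.fst ℝ ℝ ℝ)).hasFDerivAt
  have h2 : HasFDerivAt (fun H : ℝ × ℝ => ((H.2 : ℝ) : ℂ))
      (Complex.ofRealCLM.comp (ContinuousLinearMap.snd ℝ ℝ ℝ)) H :=
    (Complex.ofRealCLM.comp (ContinuousLinearMap.snd ℝ ℝ ℝ)).hasFDerivAt
  have h3 := (h1.add (h2.mul_const Complex.I)).neg
  have h4 := (Complex.hasStrictDerivAt_log hz).hasDerivAt.comp_hasFDerivAt H h3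
  refine ⟨_, h4, fun v => ?_⟩
  have h0 : (H.1 : ℂ) + H.2 * Complex.I ≠ 0 := by
    intro h; rw [h] at hz; simp at hz
  have h5 : (-((H.1 : ℂ) + H.2 * Complex.I))⁻¹ * -((v.1 : ℂ) + Complex.I * v.2)
      = (v.1 + v.2 * Complex.I) / ((H.1 : ℂ) + H.2 * Complex.I) := by
    rw [inv_neg, neg_mul_neg, div_eq_mul_inv]; ring
  rw [← h5]
  simp
  ring

lemma nrm_eq (H : ℝ × ℝ) : nrm H = ‖-((H.1 : ℂ) + H.2 * Complex.I)‖ := by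
  rw [norm_neg, Complex.norm_add_mul_I]; rfl

lemma log_nrm_eq : (fun H : ℝ × ℝ => Real.log (nrm H)) =
    fun H => Complex.reCLM (Complex.log (-((H.1 : ℂ) + H.2 * Complex.I))) := by
  funext H
  rw [nrm_eq, Complex.reCLM_apply, Complex.log_re]

lemma argS_eq : argS =
    fun H => Real.pi + Complex.imCLM (Complex.log (-((H.1 : ℂ) + H.2 * Complex.I))) := by
  funext H
  rw [Complex.imCLM_apply, Complex.log_im]; rfl

lemma log_nrm_fd (H : ℝ × ℝ) (hH : H ∈ slitP) :
    ∃ G : ℝ × ℝ →L[ℝ] ℝ, HasFDerivAt (fun H : ℝ × ℝ => Real.log (nrm H)) G H ∧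
      G (1, 0) = H.1 / (H.1 ^ 2 + H.2 ^ 2) ∧ G (0, 1) = H.2 / (H.1 ^ 2 + H.2 ^ 2) := by
  obtain ⟨G, hG, hv⟩ := clog_hasFDerivAt H hH
  refine ⟨Complex.reCLM.comp G, ?_, ?_, ?_⟩
  · rw [log_nrm_eq]
    exact Complex.reCLM.hasFDerivAt.comp H hG
  all_goals
    simp [hv, Complex.div_re, Complex.normSq_apply, Complex.inv_re, pow_two]

lemma argS_fd (H : ℝ × ℝ) (hH : H ∈ slitP) :
    ∃ G : ℝ × ℝ →L[ℝ] ℝ, HasFDerivAt argS G H ∧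
      G (1, 0) = -H.2 / (H.1 ^ 2 + H.2 ^ 2) ∧ G (0, 1) = H.1 / (H.1 ^ 2 + H.2 ^ 2) := by
  obtain ⟨G, hG, hv⟩ := clog_hasFDerivAt H hH
  refine ⟨Complex.imCLM.comp G, ?_, ?_, ?_⟩
  · rw [argS_eq]
    exact (Complex.imCLM.hasFDerivAt.comp H hG).const_add _
  all_goals
    simp [hv, Complex.div_im, Complex.normSq_apply, Complex.inv_im, pow_two]

lemma pd_an (f : ℝ × ℝ → ℝ) (hf : ∀ x, AnalyticAt ℝ f x) (v : ℝ × ℝ) (x : ℝ × ℝ) :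
    AnalyticAt ℝ (fun H => fderiv ℝ f H v) x :=
  ((ContinuousLinearMap.apply ℝ ℝ v).analyticAt _).comp (hf x).fderiv

lemma pd₁_an (f : ℝ × ℝ → ℝ) (hf : ∀ x, AnalyticAt ℝ f x) (x : ℝ × ℝ) :
    AnalyticAt ℝ (pd₁ f) x := pd_an f hf _ x

lemma pd₂_an (f : ℝ × ℝ → ℝ) (hf : ∀ x, AnalyticAt ℝ f x) (x : ℝ × ℝ) :
    AnalyticAt ℝ (pd₂ f) x := pd_an f hf _ x

lemma div_fd (f g : ℝ × ℝ → ℝ) (f' g' : ℝ × ℝ →L[ℝ] ℝ) (H : ℝ × ℝ)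
    (hf : HasFDerivAt f f' H) (hg : HasFDerivAt g g' H) (h0 : g H ≠ 0) :
    HasFDerivAt (fun H => f H / g H) ((g H)⁻¹ • f' - (f H * ((g H)⁻¹) ^ 2) • g') H := by
  have h1 := hf.mul ((hasDerivAt_inv h0).comp_hasFDerivAt H hg)
  refine (h1.congr_fderiv ?_)
  ext <;> simp <;> ring

/-- The partial derivatives of the frequency map. -/
lemma omega_pd (F s : ℝ × ℝ → ℝ) (hF : ∀ x, AnalyticAt ℝ F x)
    (hs : ∀ x, AnalyticAt ℝ s x) (H : ℝ × ℝ) (hH : H ∈ slitP) (hD : Dfun s H ≠ 0)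
    (c E A R : ℝ) (hc : c = 1 / (2 * Real.pi)) (hE : E = (Dfun s H)⁻¹)
    (hA : A = c * argS H + pd₁ s H) (hR : R = (H.1 ^ 2 + H.2 ^ 2)) :
    pd₁ (ω₂ F s) H = E * pd₁ (pd₂ F) H
        - pd₂ F H * E ^ 2 * (c * (H.1 / R) + pd₁ (pd₂ s) H) ∧
    pd₂ (ω₂ F s) H = E * pd₂ (pd₂ F) H
        - pd₂ F H * E ^ 2 * (c * (H.2 / R) + pd₂ (pd₂ s) H) ∧
    pd₁ (ω₁ F s) H = pd₁ (pd₁ F) H - (E * (pd₂ F H * (c * (-H.2 / R) + pd₁ (pd₁ s) H)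
          + A * pd₁ (pd₂ F) H)
        - pd₂ F H * A * E ^ 2 * (c * (H.1 / R) + pd₁ (pd₂ s) H)) ∧
    pd₂ (ω₁ F s) H = pd₂ (pd₁ F) H - (E * (pd₂ F H * (c * (H.1 / R) + pd₂ (pd₁ s) H)
          + A * pd₂ (pd₂ F) H)
        - pd₂ F H * A * E ^ 2 * (c * (H.2 / R) + pd₂ (pd₂ s) H)) := by
  obtain ⟨Gl, hGl, hl1, hl2⟩ := log_nrm_fd H hH
  obtain ⟨Ga, hGa, ha1, ha2⟩ := argS_fd H hH
  have dF1 := (pd₁_an F hF H).differentiableAt.hasFDerivAt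
  have dF2 := (pd₂_an F hF H).differentiableAt.hasFDerivAt
  have ds1 := (pd₁_an s hs H).differentiableAt.hasFDerivAt
  have ds2 := (pd₂_an s hs H).differentiableAt.hasFDerivAt
  have dD : HasFDerivAt (Dfun s) (c • Gl + fderiv ℝ (pd₂ s) H) H := by
    subst hc
    exact ((hGl.add_const 1).const_mul _).add ds2
  have dA : HasFDerivAt (fun H => (1 / (2 * Real.pi)) * argS H + pd₁ s H)
      (c • Ga + fderiv ℝ (pd₁ s) H) H := by
    subst hc
    exact (hGa.const_mul _).add ds1
  have d2 := div_fd _ _ _ _ H dF2 dD hD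
  have d1 := dF1.sub (div_fd _ _ _ _ H (dF2.mul dA) dD hD)
  have e2 : fderiv ℝ (ω₂ F s) H = _ := d2.fderiv
  have e1 : fderiv ℝ (ω₁ F s) H = _ := d1.fderiv
  refine ⟨?_, ?_, ?_, ?_⟩
  · rw [pd₁, e2]; simp [hl1, hE, hR, pd₁]; ring
  · rw [pd₂, e2]; simp [hl2, hE, hR, pd₂]; ring
  · rw [pd₁, e1]; simp [hl1, ha1, hE, hR, hA, hc, pd₁]; ring
  · rw [pd₂, e1]; simp [hl2, ha2, hE, hR, hA, hc, pd₂]; ring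

lemma nrm_pos (H : ℝ × ℝ) (hH : H ∈ slitP) : 0 < H.1 ^ 2 + H.2 ^ 2 := by
  simp only [slitP, Set.mem_ofPred_eq, not_and] at hH
  by_cases h : H.2 = 0
  · have : H.1 ≠ 0 := fun h1 => hH h1.ge h
    positivity
  · positivity

lemma tendsto_nrm : Tendsto nrm (𝓝[slitP] (0, 0)) (𝓝[>] 0) := by
  refine tendsto_nhdsWithin_iff.2 ⟨?_, ?_⟩
  · have : Continuous nrm := by unfold nrm; fun_prop
    have h := (this.tendsto (0, 0)).mono_left (nhdsWithin_le_nhds (s := slitP))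
    simpa [nrm] using h
  · filter_upwards [self_mem_nhdsWithin] with H hH
    exact Real.sqrt_pos.2 (nrm_pos H hH)

lemma tendsto_L : Tendsto (fun H => Real.log (nrm H)) (𝓝[slitP] (0, 0)) atBot :=
  Real.tendsto_log_nhdsGT_zero.comp tendsto_nrm

lemma tendsto_Lmul (g : ℝ × ℝ → ℝ) (hg : ∀ H, |g H| ≤ nrm H) :
    Tendsto (fun H => Real.log (nrm H) * g H) (𝓝[slitP] (0, 0)) (𝓝 0) := by
  have h : Tendsto (fun H => |Real.log (nrm H) * nrm H|) (𝓝[slitP] (0, 0)) (𝓝 0) := by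
    have := ((tendsto_log_mul_rpow_nhdsGT_zero zero_lt_one).comp tendsto_nrm).abs
    simpa [Function.comp_def] using this
  refine squeeze_zero_norm (fun H => ?_) h
  rw [Real.norm_eq_abs, abs_mul, abs_mul]
  exact mul_le_mul_of_nonneg_left ((hg H).trans (le_abs_self _)) (abs_nonneg _)

lemma an_tendsto (f : ℝ × ℝ → ℝ) (hf : ∀ x, AnalyticAt ℝ f x) :
    Tendsto f (𝓝[slitP] (0, 0)) (𝓝 (f (0, 0))) :=
  ((hf (0, 0)).continuousAt.tendsto).mono_left nhdsWithin_le_nhds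

lemma tendsto_LE (s : ℝ × ℝ → ℝ) (hs : ∀ x, AnalyticAt ℝ s x) :
    Tendsto (fun H => Real.log (nrm H) * (Dfun s H)⁻¹) (𝓝[slitP] (0, 0))
      (𝓝 (2 * Real.pi)) := by
  have hi := tendsto_inv_atBot_zero.comp tendsto_L
  have h2 := an_tendsto _ (pd₂_an s hs)
  have h : Tendsto (fun H => (1 / (2 * Real.pi)) * (1 + (Real.log (nrm H))⁻¹)
      + pd₂ s H * (Real.log (nrm H))⁻¹) (𝓝[slitP] (0, 0))
      (𝓝 ((1 / (2 * Real.pi)) * (1 + 0) + pd₂ s (0,0) * 0)) :=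
    ((hi.const_add 1).const_mul _).add (h2.mul hi)
  have h' := h.inv₀ (by simp [Real.pi_ne_zero])
  have e : ((1 / (2 * Real.pi)) * (1 + 0) + pd₂ s (0,0) * 0)⁻¹ = 2 * Real.pi := by simp
  rw [e] at h'
  refine h'.congr' ?_
  filter_upwards [tendsto_L.eventually_lt_atBot 0] with H hH
  have : Dfun s H = Real.log (nrm H) * ((1 / (2 * Real.pi)) * (1 + (Real.log (nrm H))⁻¹)
      + pd₂ s H * (Real.log (nrm H))⁻¹) := by
    have h0 := hH.ne
    unfold Dfun; field_simp
  rw [this, mul_inv, ← mul_assoc, mul_inv_cancel₀ hH.ne, one_mul]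

lemma tendsto_E (s : ℝ × ℝ → ℝ) (hs : ∀ x, AnalyticAt ℝ s x) :
    Tendsto (fun H => (Dfun s H)⁻¹) (𝓝[slitP] (0, 0)) (𝓝 0) := by
  have h := (tendsto_inv_atBot_zero.comp tendsto_L).mul (tendsto_LE s hs)
  rw [zero_mul] at h
  refine h.congr' ?_
  filter_upwards [tendsto_L.eventually_lt_atBot 0] with H hH
  simp only [Function.comp]
  rw [← mul_assoc, inv_mul_cancel₀ hH.ne, one_mul]

lemma D_ne (s : ℝ × ℝ → ℝ) (hs : ∀ x, AnalyticAt ℝ s x) :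
    ∀ᶠ H in 𝓝[slitP] (0, 0), Dfun s H ≠ 0 := by
  have h := (tendsto_LE s hs).eventually_ne (b₂ := 0) (by simp [Real.pi_ne_zero])
  filter_upwards [h] with H hH h0
  exact hH (by simp [h0])

lemma tendsto_AE (s : ℝ × ℝ → ℝ) (hs : ∀ x, AnalyticAt ℝ s x) :
    Tendsto (fun H => ((1 / (2 * Real.pi)) * argS H + pd₁ s H) * (Dfun s H)⁻¹)
      (𝓝[slitP] (0, 0)) (𝓝 0) := by
  have hE := tendsto_E s hs
  have h1 : Tendsto (fun H => argS H * (Dfun s H)⁻¹) (𝓝[slitP] (0, 0)) (𝓝 0) := by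
    have h : Tendsto (fun H => (2 * Real.pi) * |(Dfun s H)⁻¹|) (𝓝[slitP] (0, 0)) (𝓝 0) := by
      simpa using hE.abs.const_mul (2 * Real.pi)
    refine squeeze_zero_norm (fun H => ?_) h
    rw [Real.norm_eq_abs, abs_mul]
    refine mul_le_mul_of_nonneg_right ?_ (abs_nonneg _)
    have h1 := Complex.neg_pi_lt_arg (-((H.1 : ℂ) + H.2 * Complex.I))
    have h2 := Complex.arg_le_pi (-((H.1 : ℂ) + H.2 * Complex.I))
    unfold argS
    rw [abs_le]
    constructor <;> linarith [Real.pi_pos]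
  have h2 := (h1.const_mul (1 / (2 * Real.pi))).add ((an_tendsto _ (pd₁_an s hs)).mul hE)
  simp only [mul_zero, add_zero] at h2
  refine h2.congr fun H => ?_
  ring

theorem stmt7 (F₀ s : ℝ × ℝ → ℝ) (hF : ∀ x, AnalyticAt ℝ F₀ x)
    (hs : ∀ x, AnalyticAt ℝ s x) :
    Tendsto (fun H : ℝ × ℝ =>
        (!![Real.log (nrm H), 0; 0, (Real.log (nrm H)) ^ 2 / (2 * Real.pi)] *
          Dω F₀ s H * !![H.2, -H.1; -H.1, -H.2] : Matrix (Fin 2) (Fin 2) ℝ))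
      (𝓝[slitP] (0, 0))
      (𝓝 (pd₂ F₀ (0, 0) • (1 : Matrix (Fin 2) (Fin 2) ℝ))) := by
  have tLE := tendsto_LE s hs
  have tE := tendsto_E s hs
  have tAE := tendsto_AE s hs
  have t1 := tendsto_Lmul (fun H => H.1) (fun H => Real.abs_le_sqrt (by nlinarith [sq_nonneg H.2]))
  have t2 := tendsto_Lmul (fun H => H.2) (fun H => Real.abs_le_sqrt (by nlinarith [sq_nonneg H.1]))
  have tf := an_tendsto _ (pd₂_an F₀ hF)
  have ta := an_tendsto _ (pd₁_an _ (pd₁_an F₀ hF))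
  have tb := an_tendsto _ (pd₂_an _ (pd₁_an F₀ hF))
  have tp := an_tendsto _ (pd₁_an _ (pd₂_an F₀ hF))
  have tq := an_tendsto _ (pd₂_an _ (pd₂_an F₀ hF))
  have t11 := an_tendsto _ (pd₁_an _ (pd₁_an s hs))
  have t12 := an_tendsto _ (pd₂_an _ (pd₁_an s hs))
  have t21 := an_tendsto _ (pd₁_an _ (pd₂_an s hs))
  have t22 := an_tendsto _ (pd₂_an _ (pd₂_an s hs))
  -- regular parts of the derivatives
  have u1 := ((ta.sub (tp.mul tAE)).sub ((tf.mul t11).mul tE)).add (((tf.mul tAE).mul t21).mul tE)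
  have u2 := ((tb.sub (tq.mul tAE)).sub ((tf.mul t12).mul tE)).add (((tf.mul tAE).mul t22).mul tE)
  have w1 := (tp.mul tLE).sub (((tf.mul t21).mul tLE).mul tE)
  have w2 := (tq.mul tLE).sub (((tf.mul t22).mul tLE).mul tE)
  have m11 := ((t2.mul u1).sub (t1.mul u2)).add ((tf.mul tLE).mul_const (1 / (2 * Real.pi)))
  have m12 := (((t1.mul u1).add (t2.mul u2)).add
    (((tf.mul tAE).mul tLE).mul_const (1 / (2 * Real.pi)))).neg
  have m21 := ((t2.mul w1).sub (t1.mul w2)).mul_const (1 / (2 * Real.pi))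
  have m22 := ((tf.mul (tLE.mul tLE)).mul_const ((1 / (2 * Real.pi)) ^ 2)).sub
    (((t1.mul w1).add (t2.mul w2)).mul_const (1 / (2 * Real.pi)))
  have hpi := Real.pi_ne_zero
  refine tendsto_pi_nhds.2 fun i => tendsto_pi_nhds.2 fun j => ?_
  have hev := (D_ne s hs).and (self_mem_nhdsWithin (a := ((0 : ℝ), (0 : ℝ))) (s := slitP))
  fin_cases i <;> fin_cases j
  · refine Tendsto.congr' (f₁ := _) ?_ (Eq.subst (motive := fun l => Tendsto _ _ (𝓝 l)) ?_ m11)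
    · filter_upwards [hev] with H hH
      have hR := (nrm_pos H hH.2).ne'
      obtain ⟨o1, o2, o3, o4⟩ := omega_pd F₀ s hF hs H hH.2 hH.1 _ _ _ _ rfl rfl rfl rfl
      have k1 : H.1 * (H.1 / (H.1 ^ 2 + H.2 ^ 2)) + H.2 * (H.2 / (H.1 ^ 2 + H.2 ^ 2)) = 1 := by
        field_simp
      have k2 : H.2 * (H.1 / (H.1 ^ 2 + H.2 ^ 2)) - H.1 * (H.2 / (H.1 ^ 2 + H.2 ^ 2)) = 0 := by
        ring
      simp only [Dω, Matrix.mul_apply, Fin.sum_univ_two, o1, o2, o3, o4, neg_div,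
        div_eq_mul_one_div (Real.log (nrm H) ^ 2) (2 * Real.pi)]
      simp only [Matrix.of_apply, Matrix.cons_val', Matrix.cons_val_zero, Matrix.cons_val_one,
        Matrix.cons_val_fin_one, Fin.zero_eta, Fin.mk_one, Fin.isValue]
      generalize H.1 / (H.1 ^ 2 + H.2 ^ 2) = x at *
      generalize H.2 / (H.1 ^ 2 + H.2 ^ 2) = y at *
      generalize (Dfun s H)⁻¹ = E at *
      generalize 1 / (2 * Real.pi) = c at *
      generalize Real.log (nrm H) = L at *
      generalize argS H = A at *
      linear_combination (-(pd₂ F₀ H * L * E * c)) * k1 - (pd₂ F₀ H * (c * A + pd₁ s H) * E ^ 2 * c * L) * k2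
    · simp <;> field_simp
  · refine Tendsto.congr' (f₁ := _) ?_ (Eq.subst (motive := fun l => Tendsto _ _ (𝓝 l)) ?_ m12)
    · filter_upwards [hev] with H hH
      have hR := (nrm_pos H hH.2).ne'
      obtain ⟨o1, o2, o3, o4⟩ := omega_pd F₀ s hF hs H hH.2 hH.1 _ _ _ _ rfl rfl rfl rfl
      have k1 : H.1 * (H.1 / (H.1 ^ 2 + H.2 ^ 2)) + H.2 * (H.2 / (H.1 ^ 2 + H.2 ^ 2)) = 1 := by
        field_simp
      have k2 : H.2 * (H.1 / (H.1 ^ 2 + H.2 ^ 2)) - H.1 * (H.2 / (H.1 ^ 2 + H.2 ^ 2)) = 0 := by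
        ring
      simp only [Dω, Matrix.mul_apply, Fin.sum_univ_two, o1, o2, o3, o4, neg_div,
        div_eq_mul_one_div (Real.log (nrm H) ^ 2) (2 * Real.pi)]
      simp only [Matrix.of_apply, Matrix.cons_val', Matrix.cons_val_zero, Matrix.cons_val_one,
        Matrix.cons_val_fin_one, Fin.zero_eta, Fin.mk_one, Fin.isValue]
      generalize H.1 / (H.1 ^ 2 + H.2 ^ 2) = x at *
      generalize H.2 / (H.1 ^ 2 + H.2 ^ 2) = y at *
      generalize (Dfun s H)⁻¹ = E at *
      generalize 1 / (2 * Real.pi) = c at *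
      generalize Real.log (nrm H) = L at *
      generalize argS H = A at *
      linear_combination ((pd₂ F₀ H * (c * A + pd₁ s H) * E ^ 2 * c * L)) * k1 - (pd₂ F₀ H * E * c * L) * k2
    · simp <;> field_simp
  · refine Tendsto.congr' (f₁ := _) ?_ (Eq.subst (motive := fun l => Tendsto _ _ (𝓝 l)) ?_ m21)
    · filter_upwards [hev] with H hH
      have hR := (nrm_pos H hH.2).ne'
      obtain ⟨o1, o2, o3, o4⟩ := omega_pd F₀ s hF hs H hH.2 hH.1 _ _ _ _ rfl rfl rfl rfl
      have k1 : H.1 * (H.1 / (H.1 ^ 2 + H.2 ^ 2)) + H.2 * (H.2 / (H.1 ^ 2 + H.2 ^ 2)) = 1 := by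
        field_simp
      have k2 : H.2 * (H.1 / (H.1 ^ 2 + H.2 ^ 2)) - H.1 * (H.2 / (H.1 ^ 2 + H.2 ^ 2)) = 0 := by
        ring
      simp only [Dω, Matrix.mul_apply, Fin.sum_univ_two, o1, o2, o3, o4, neg_div,
        div_eq_mul_one_div (Real.log (nrm H) ^ 2) (2 * Real.pi)]
      simp only [Matrix.of_apply, Matrix.cons_val', Matrix.cons_val_zero, Matrix.cons_val_one,
        Matrix.cons_val_fin_one, Fin.zero_eta, Fin.mk_one, Fin.isValue]
      generalize H.1 / (H.1 ^ 2 + H.2 ^ 2) = x at *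
      generalize H.2 / (H.1 ^ 2 + H.2 ^ 2) = y at *
      generalize (Dfun s H)⁻¹ = E at *
      generalize 1 / (2 * Real.pi) = c at *
      generalize Real.log (nrm H) = L at *
      generalize argS H = A at *
      linear_combination (pd₂ F₀ H * E ^ 2 * c ^ 2 * L ^ 2) * k2
    · simp <;> field_simp
  · refine Tendsto.congr' (f₁ := _) ?_ (Eq.subst (motive := fun l => Tendsto _ _ (𝓝 l)) ?_ m22)
    · filter_upwards [hev] with H hH
      have hR := (nrm_pos H hH.2).ne'
      obtain ⟨o1, o2, o3, o4⟩ := omega_pd F₀ s hF hs H hH.2 hH.1 _ _ _ _ rfl rfl rfl rfl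
      have k1 : H.1 * (H.1 / (H.1 ^ 2 + H.2 ^ 2)) + H.2 * (H.2 / (H.1 ^ 2 + H.2 ^ 2)) = 1 := by
        field_simp
      have k2 : H.2 * (H.1 / (H.1 ^ 2 + H.2 ^ 2)) - H.1 * (H.2 / (H.1 ^ 2 + H.2 ^ 2)) = 0 := by
        ring
      simp only [Dω, Matrix.mul_apply, Fin.sum_univ_two, o1, o2, o3, o4, neg_div,
        div_eq_mul_one_div (Real.log (nrm H) ^ 2) (2 * Real.pi)]
      simp only [Matrix.of_apply, Matrix.cons_val', Matrix.cons_val_zero, Matrix.cons_val_one,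
        Matrix.cons_val_fin_one, Fin.zero_eta, Fin.mk_one, Fin.isValue]
      generalize H.1 / (H.1 ^ 2 + H.2 ^ 2) = x at *
      generalize H.2 / (H.1 ^ 2 + H.2 ^ 2) = y at *
      generalize (Dfun s H)⁻¹ = E at *
      generalize 1 / (2 * Real.pi) = c at *
      generalize Real.log (nrm H) = L at *
      generalize argS H = A at *
      linear_combination (-(pd₂ F₀ H * E ^ 2 * c ^ 2 * L ^ 2)) * k1
    · simp <;> field_simp
end

section
/- Let F₀, s : ℝ² → ℝ be real analytic. Then (1/(2π)) · |H|² · (ln|H|)³ · det Dω(H) → −(∂F₀/∂H₂(0))² as H → 0 within the slit plane P. -/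
open Real Filter Topology MeasureTheory

lemma hasFDerivAt_argS {H : ℝ × ℝ} (hH : H ∈ slitP) :
    DifferentiableAt ℝ argS H ∧ pd₁ argS H = -H.2 / (H.1 ^ 2 + H.2 ^ 2) ∧
      pd₂ argS H = H.1 / (H.1 ^ 2 + H.2 ^ 2) := by
  let l : ℝ × ℝ →L[ℝ] ℂ :=
    -(Complex.ofRealCLM.comp (ContinuousLinearMap.fst ℝ ℝ ℝ) +
      (Complex.I) • (Complex.ofRealCLM.comp (ContinuousLinearMap.snd ℝ ℝ ℝ)))
  have hl : ∀ K : ℝ × ℝ, l K = -((K.1 : ℂ) + K.2 * Complex.I) := by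
    intro K; simp [l]; ring
  have hmem : l H ∈ Complex.slitPlane := by
    rw [hl, Complex.mem_slitPlane_iff]
    simp [slitP] at hH ⊢
    by_cases h : H.1 < 0
    · left; exact h
    · right; exact hH (not_lt.mp h)
  have h1 := ((Complex.hasDerivAt_log hmem).hasFDerivAt.restrictScalars ℝ).comp H l.hasFDerivAt
  have h2 := (Complex.imCLM.hasFDerivAt.comp H h1).const_add Real.pi
  have he : (fun x => Real.pi + (⇑Complex.imCLM ∘ Complex.log ∘ ⇑l) x) = argS := by
    funext K; simp [argS, hl, Complex.log_im]
  rw [he] at h2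
  refine ⟨h2.differentiableAt, ?_, ?_⟩
  · rw [pd₁, h2.fderiv]
    simp [hl, Complex.normSq_apply, Complex.inv_im]
    ring
  · rw [pd₂, h2.fderiv]
    simp [hl, Complex.normSq_apply, Complex.inv_im, Complex.inv_re]
    ring

lemma q_pos {H : ℝ × ℝ} (hH : H ∈ slitP) : 0 < H.1 ^ 2 + H.2 ^ 2 := by
  by_contra h
  have h1 : H.1 = 0 := by nlinarith [sq_nonneg H.1, sq_nonneg H.2]
  have h2 : H.2 = 0 := by nlinarith [sq_nonneg H.1, sq_nonneg H.2]
  exact hH ⟨h1.ge, h2⟩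

lemma hasFDerivAt_lognrm {H : ℝ × ℝ} (hH : H ∈ slitP) :
    DifferentiableAt ℝ (fun H => Real.log (nrm H)) H ∧
      pd₁ (fun H => Real.log (nrm H)) H = H.1 / (H.1 ^ 2 + H.2 ^ 2) ∧
      pd₂ (fun H => Real.log (nrm H)) H = H.2 / (H.1 ^ 2 + H.2 ^ 2) := by
  have hq := q_pos hH
  have he : (fun H : ℝ × ℝ => Real.log (nrm H)) =
      fun H => (1 / 2 : ℝ) * Real.log (H.1 ^ 2 + H.2 ^ 2) := by
    funext K; rw [nrm, Real.log_sqrt (by positivity)]; ring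
  have k1 : HasFDerivAt (fun K : ℝ × ℝ => K.1) (ContinuousLinearMap.fst ℝ ℝ ℝ) H := hasFDerivAt_fst
  have k2 : HasFDerivAt (fun K : ℝ × ℝ => K.2) (ContinuousLinearMap.snd ℝ ℝ ℝ) H := hasFDerivAt_snd
  have h := (((k1.pow 2).add (k2.pow 2)).log hq.ne').const_mul (1 / 2 : ℝ)
  have h' := h.congr_of_eventuallyEq (f₁ := fun H : ℝ × ℝ => Real.log (nrm H))
    (Filter.Eventually.of_forall fun K => congrFun he K)
  refine ⟨h'.differentiableAt, ?_, ?_⟩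
  · rw [pd₁, h'.fderiv]
    simp
    field_simp
  · rw [pd₂, h'.fderiv]
    simp
    field_simp

lemma pd_contDiff {f : ℝ × ℝ → ℝ} (hf : ContDiff ℝ ⊤ f) (v : ℝ × ℝ) :
    ContDiff ℝ ⊤ (fun H => fderiv ℝ f H v) :=
  (hf.fderiv_right (m := ⊤) (by simp)).clm_apply contDiff_const

lemma pd₁_contDiff {f : ℝ × ℝ → ℝ} (hf : ContDiff ℝ ⊤ f) : ContDiff ℝ ⊤ (pd₁ f) :=
  pd_contDiff hf _

lemma pd₂_contDiff {f : ℝ × ℝ → ℝ} (hf : ContDiff ℝ ⊤ f) : ContDiff ℝ ⊤ (pd₂ f) :=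
  pd_contDiff hf _

lemma Dfun_deriv {s : ℝ × ℝ → ℝ} (hs : ContDiff ℝ ⊤ s) {H : ℝ × ℝ} (hH : H ∈ slitP) :
    DifferentiableAt ℝ (Dfun s) H ∧
    pd₁ (Dfun s) H = 1 / (2 * Real.pi) * (H.1 / (H.1 ^ 2 + H.2 ^ 2)) + pd₁ (pd₂ s) H ∧
    pd₂ (Dfun s) H = 1 / (2 * Real.pi) * (H.2 / (H.1 ^ 2 + H.2 ^ 2)) + pd₂ (pd₂ s) H := by
  obtain ⟨h0, h1, h2⟩ := hasFDerivAt_lognrm hH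
  have hd : DifferentiableAt ℝ (pd₂ s) H := (pd₂_contDiff hs).differentiable (by simp) H
  have h := ((h0.hasFDerivAt.add_const 1).const_mul (1 / (2 * Real.pi))).add hd.hasFDerivAt
  have h' : HasFDerivAt (Dfun s) _ H := h
  rw [← h1, ← h2]
  refine ⟨h'.differentiableAt, ?_, ?_⟩
  · rw [pd₁, h'.fderiv]; rfl
  · rw [pd₂, h'.fderiv]; rfl

/-- the function A -/
noncomputable def Afun (s : ℝ × ℝ → ℝ) (H : ℝ × ℝ) : ℝ :=
  (1 / (2 * Real.pi)) * argS H + pd₁ s H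

lemma Afun_deriv {s : ℝ × ℝ → ℝ} (hs : ContDiff ℝ ⊤ s) {H : ℝ × ℝ} (hH : H ∈ slitP) :
    DifferentiableAt ℝ (Afun s) H ∧
    pd₁ (Afun s) H = 1 / (2 * Real.pi) * (-H.2 / (H.1 ^ 2 + H.2 ^ 2)) + pd₁ (pd₁ s) H ∧
    pd₂ (Afun s) H = 1 / (2 * Real.pi) * (H.1 / (H.1 ^ 2 + H.2 ^ 2)) + pd₂ (pd₁ s) H := by
  obtain ⟨h0, h1, h2⟩ := hasFDerivAt_argS hH
  have hd : DifferentiableAt ℝ (pd₁ s) H := (pd₁_contDiff hs).differentiable (by simp) H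
  have h := (h0.hasFDerivAt.const_mul (1 / (2 * Real.pi))).add hd.hasFDerivAt
  have h' : HasFDerivAt (Afun s) _ H := h
  rw [← h1, ← h2]
  refine ⟨h'.differentiableAt, ?_, ?_⟩
  · rw [pd₁, h'.fderiv]; rfl
  · rw [pd₂, h'.fderiv]; rfl

lemma ω₂_deriv {F s : ℝ × ℝ → ℝ} (hF : ContDiff ℝ ⊤ F) (hs : ContDiff ℝ ⊤ s) {H : ℝ × ℝ}
    (hH : H ∈ slitP) (hD : Dfun s H ≠ 0) :
    DifferentiableAt ℝ (ω₂ F s) H ∧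
    pd₁ (ω₂ F s) H = pd₁ (pd₂ F) H / Dfun s H - pd₂ F H * pd₁ (Dfun s) H / Dfun s H ^ 2 ∧
    pd₂ (ω₂ F s) H = pd₂ (pd₂ F) H / Dfun s H - pd₂ F H * pd₂ (Dfun s) H / Dfun s H ^ 2 := by
  obtain ⟨h0, -, -⟩ := Dfun_deriv hs hH
  have hd : DifferentiableAt ℝ (pd₂ F) H := (pd₂_contDiff hF).differentiable (by simp) H
  have h := hd.hasFDerivAt.mul ((hasDerivAt_inv hD).comp_hasFDerivAt H h0.hasFDerivAt)
  have h' : HasFDerivAt (ω₂ F s) _ H := h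
  refine ⟨h'.differentiableAt, ?_, ?_⟩
  · rw [pd₁, h'.fderiv]; simp [pd₁]; field_simp; ring
  · rw [pd₂, h'.fderiv]; simp [pd₂]; field_simp; ring

lemma ω₁_deriv {F s : ℝ × ℝ → ℝ} (hF : ContDiff ℝ ⊤ F) (hs : ContDiff ℝ ⊤ s) {H : ℝ × ℝ}
    (hH : H ∈ slitP) (hD : Dfun s H ≠ 0) :
    pd₁ (ω₁ F s) H = pd₁ (pd₁ F) H - (Afun s H * pd₁ (ω₂ F s) H + ω₂ F s H * pd₁ (Afun s) H) ∧
    pd₂ (ω₁ F s) H = pd₂ (pd₁ F) H - (Afun s H * pd₂ (ω₂ F s) H + ω₂ F s H * pd₂ (Afun s) H) := by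
  obtain ⟨h0, -, -⟩ := Afun_deriv hs hH
  obtain ⟨h1, -, -⟩ := ω₂_deriv hF hs hH hD
  have hd : DifferentiableAt ℝ (pd₁ F) H := (pd₁_contDiff hF).differentiable (by simp) H
  have h := hd.hasFDerivAt.sub (h0.hasFDerivAt.mul h1.hasFDerivAt)
  have he : ω₁ F s = pd₁ F - Afun s * ω₂ F s := by
    funext K; simp [ω₁, ω₂, Afun]; ring
  rw [← he] at h
  refine ⟨?_, ?_⟩
  · rw [pd₁, h.fderiv]; simp [pd₁]
  · rw [pd₂, h.fderiv]; simp [pd₂]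

lemma tendsto_helper {α : Type*} {f g : α → ℝ} {l : Filter α} {a b : ℝ}
    (h : Tendsto f l (𝓝 a)) (hab : a = b) (hfg : f =ᶠ[l] g) : Tendsto g l (𝓝 b) :=
  hab ▸ h.congr' hfg

lemma det_alg (p r L D H1 H2 a1 a2 b b1 b2 A s11 s12 s21 s22 D1 D2 A1 A2 w1 w2 : ℝ)
    (hr : r ≠ 0) (hD : D ≠ 0) (hq : r ^ 2 = H1 ^ 2 + H2 ^ 2)
    (hD1 : D1 = p * (H1 / r ^ 2) + s21) (hD2 : D2 = p * (H2 / r ^ 2) + s22)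
    (hA1 : A1 = p * (-H2 / r ^ 2) + s11) (hA2 : A2 = p * (H1 / r ^ 2) + s12)
    (hw1 : w1 = b1 / D - b * D1 / D ^ 2) (hw2 : w2 = b2 / D - b * D2 / D ^ 2) :
    p * r ^ 2 * L ^ 3 * ((a1 - (A * w1 + b / D * A1)) * w2 - (a2 - (A * w2 + b / D * A2)) * w1) =
    p * (a1 * ((r * L) ^ 2 * (L / D) * b2
          - (L / D) ^ 2 * b * (p * (H2 * L) + (r * L) * r * s22))
        - a2 * ((r * L) ^ 2 * (L / D) * b1
          - (L / D) ^ 2 * b * (p * (H1 * L) + (r * L) * r * s21))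
        + b ^ 2 * (L / D) ^ 3 * (-p ^ 2 + p * (H2 * s11 - H2 * s22 - H1 * s21 - H1 * s12)
          + r ^ 2 * (s11 * s22 - s12 * s21))
        - (L / D) ^ 2 * b * (b2 * (-p * (H2 * L) + (r * L) * r * s11)
          - b1 * (p * (H1 * L) + (r * L) * r * s12))) := by
  have e1 : (a1 - (A * w1 + b / D * A1)) * w2 - (a2 - (A * w2 + b / D * A2)) * w1
      = a1 * w2 - a2 * w1 + b ^ 2 / D ^ 3 * (A1 * D2 - A2 * D1)
        - b / D ^ 2 * (A1 * b2 - A2 * b1) := by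
    rw [hw1, hw2]; field_simp; ring
  have e2 : r ^ 2 * (A1 * D2 - A2 * D1) =
      (-p ^ 2 + p * (H2 * s11 - H2 * s22 - H1 * s21 - H1 * s12)
          + r ^ 2 * (s11 * s22 - s12 * s21)) := by
    have : p ^ 2 = p ^ 2 * ((H1 ^ 2 + H2 ^ 2) / r ^ 2) := by rw [← hq]; field_simp
    rw [this, hA1, hA2, hD1, hD2]; field_simp; ring
  rw [e1, ← e2, hw1, hw2]
  have f1 : p * (H1 * L) + (r * L) * r * s21 = r ^ 2 * L * D1 := by rw [hD1]; field_simp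
  have f2 : p * (H2 * L) + (r * L) * r * s22 = r ^ 2 * L * D2 := by rw [hD2]; field_simp
  have f3 : -p * (H2 * L) + (r * L) * r * s11 = r ^ 2 * L * A1 := by rw [hA1]; field_simp
  have f4 : p * (H1 * L) + (r * L) * r * s12 = r ^ 2 * L * A2 := by rw [hA2]; field_simp
  rw [f1, f2, f3, f4]
  field_simp

/-- If `F₀` and `s` are real analytic, then
`(1/(2π)) |H|² ln³|H| · det Dω(H) → −(∂F₀/∂H₂(0))²` as `H → 0` within the slit plane. -/
theorem stmt8 (F₀ s : ℝ × ℝ → ℝ) (hF : ∀ x, AnalyticAt ℝ F₀ x)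
    (hs : ∀ x, AnalyticAt ℝ s x) :
    Tendsto (fun H : ℝ × ℝ =>
        (1 / (2 * Real.pi)) * (nrm H) ^ 2 * (Real.log (nrm H)) ^ 3 * (Dω F₀ s H).det)
      (𝓝[slitP] (0, 0)) (𝓝 (-(pd₂ F₀ (0, 0)) ^ 2)) := by
  have hF' : ContDiff ℝ ⊤ F₀ := contDiff_iff_contDiffAt.2 fun x => (hF x).contDiffAt
  have hs' : ContDiff ℝ ⊤ s := contDiff_iff_contDiffAt.2 fun x => (hs x).contDiffAt
  have hc : ∀ {f : ℝ × ℝ → ℝ}, ContDiff ℝ ⊤ f →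
      Tendsto f (𝓝[slitP] (0, 0)) (𝓝 (f (0, 0))) := fun h =>
    h.continuous.continuousAt.tendsto.mono_left nhdsWithin_le_nhds
  have hself : ∀ᶠ H in 𝓝[slitP] ((0 : ℝ), (0 : ℝ)), H ∈ slitP := self_mem_nhdsWithin
  have hrpos : ∀ᶠ H in 𝓝[slitP] ((0 : ℝ), (0 : ℝ)), 0 < nrm H := by
    filter_upwards [hself] with H hH
    exact Real.sqrt_pos.2 (q_pos hH)
  have hr0 : Tendsto nrm (𝓝[slitP] (0, 0)) (𝓝 0) := by
    have : Continuous nrm := by unfold nrm; fun_prop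
    have h := this.tendsto ((0 : ℝ), (0 : ℝ))
    have e : nrm (0, 0) = 0 := by simp [nrm]
    rw [e] at h
    exact h.mono_left nhdsWithin_le_nhds
  have hr : Tendsto nrm (𝓝[slitP] (0, 0)) (𝓝[>] 0) :=
    tendsto_nhdsWithin_iff.2 ⟨hr0, hrpos⟩
  have hL : Tendsto (fun H => Real.log (nrm H)) (𝓝[slitP] (0, 0)) atBot :=
    Real.tendsto_log_nhdsGT_zero.comp hr
  have hrL : Tendsto (fun H => nrm H * Real.log (nrm H)) (𝓝[slitP] (0, 0)) (𝓝 0) := by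
    have := (Real.continuous_mul_log.tendsto 0).comp hr0
    simpa [Function.comp_def] using this
  have h1 : Tendsto (fun H : ℝ × ℝ => H.1) (𝓝[slitP] (0, 0)) (𝓝 0) :=
    (continuous_fst.tendsto ((0 : ℝ), (0 : ℝ))).mono_left nhdsWithin_le_nhds
  have h2 : Tendsto (fun H : ℝ × ℝ => H.2) (𝓝[slitP] (0, 0)) (𝓝 0) :=
    (continuous_snd.tendsto ((0 : ℝ), (0 : ℝ))).mono_left nhdsWithin_le_nhds
  have h1L : Tendsto (fun H : ℝ × ℝ => H.1 * Real.log (nrm H)) (𝓝[slitP] (0, 0)) (𝓝 0) := by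
    refine squeeze_zero_norm (fun H => ?_) (by simpa using hrL.abs)
    rw [Real.norm_eq_abs, abs_mul]
    refine mul_le_mul_of_nonneg_right ?_ (abs_nonneg _)
    rw [abs_of_nonneg (show 0 ≤ nrm H from Real.sqrt_nonneg _)]
    exact Real.abs_le_sqrt (by nlinarith [sq_nonneg H.2])
  have h2L : Tendsto (fun H : ℝ × ℝ => H.2 * Real.log (nrm H)) (𝓝[slitP] (0, 0)) (𝓝 0) := by
    refine squeeze_zero_norm (fun H => ?_) (by simpa using hrL.abs)
    rw [Real.norm_eq_abs, abs_mul]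
    refine mul_le_mul_of_nonneg_right ?_ (abs_nonneg _)
    rw [abs_of_nonneg (show 0 ≤ nrm H from Real.sqrt_nonneg _)]
    exact Real.abs_le_sqrt (by nlinarith [sq_nonneg H.1])
  have hLinv := hL.inv_tendsto_atBot
  have hp : (1 / (2 * Real.pi)) ≠ 0 := by positivity
  have hLne : ∀ᶠ H in 𝓝[slitP] ((0 : ℝ), (0 : ℝ)), Real.log (nrm H) ≠ 0 :=
    (hL.eventually_lt_atBot 0).mono fun H h => h.ne
  have hDL : Tendsto (fun H => Dfun s H / Real.log (nrm H)) (𝓝[slitP] (0, 0))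
      (𝓝 (1 / (2 * Real.pi))) := by
    have h := ((hLinv.const_add 1).const_mul (1 / (2 * Real.pi))).add
      ((hc (pd₂_contDiff hs')).mul hLinv)
    simp only [add_zero, mul_zero, mul_one] at h
    refine h.congr' ?_
    filter_upwards [hLne] with H hH
    simp only [Dfun, Pi.inv_apply]
    field_simp
  have hDne : ∀ᶠ H in 𝓝[slitP] ((0 : ℝ), (0 : ℝ)), Dfun s H ≠ 0 := by
    filter_upwards [hDL.eventually_ne hp] with H hH h
    exact hH (by rw [h, zero_div])
  have hu : Tendsto (fun H => Real.log (nrm H) / Dfun s H) (𝓝[slitP] (0, 0))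
      (𝓝 (1 / (2 * Real.pi))⁻¹) := by
    refine (hDL.inv₀ hp).congr fun H => ?_
    rw [inv_div]
  have hb := hc (pd₂_contDiff hF')
  have ha1 := hc (pd₁_contDiff (pd₁_contDiff hF'))
  have ha2 := hc (pd₂_contDiff (pd₁_contDiff hF'))
  have hb1 := hc (pd₁_contDiff (pd₂_contDiff hF'))
  have hb2 := hc (pd₂_contDiff (pd₂_contDiff hF'))
  have hs11 := hc (pd₁_contDiff (pd₁_contDiff hs'))
  have hs12 := hc (pd₂_contDiff (pd₁_contDiff hs'))
  have hs21 := hc (pd₁_contDiff (pd₂_contDiff hs'))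
  have hs22 := hc (pd₂_contDiff (pd₂_contDiff hs'))
  generalize hpp : 1 / (2 * Real.pi) = p at *
  have T1 := ha1.mul ((((hrL.pow 2).mul hu).mul hb2).sub
    (((hu.pow 2).mul hb).mul ((h2L.const_mul p).add ((hrL.mul hr0).mul hs22))))
  have T2 := ha2.mul ((((hrL.pow 2).mul hu).mul hb1).sub
    (((hu.pow 2).mul hb).mul ((h1L.const_mul p).add ((hrL.mul hr0).mul hs21))))
  have T3 := ((hb.pow 2).mul (hu.pow 3)).mul
    ((((((h2.mul hs11).sub (h2.mul hs22)).sub (h1.mul hs21)).sub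
      (h1.mul hs12)).const_mul p |>.const_add (-p ^ 2)).add
      ((hr0.pow 2).mul ((hs11.mul hs22).sub (hs12.mul hs21))))
  have T4 := ((hu.pow 2).mul hb).mul
    ((hb2.mul ((h2L.const_mul (-p)).add ((hrL.mul hr0).mul hs11))).sub
      (hb1.mul ((h1L.const_mul p).add ((hrL.mul hr0).mul hs12))))
  have T := (((T1.sub T2).add T3).sub T4).const_mul p
  refine tendsto_helper T ?_ ?_
  · field_simp
    ring
  · filter_upwards [hself, hrpos, hDne] with H hH hrp hD
    have hq : nrm H ^ 2 = H.1 ^ 2 + H.2 ^ 2 := Real.sq_sqrt (q_pos hH).le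
    obtain ⟨-, hD1, hD2⟩ := Dfun_deriv hs' hH
    obtain ⟨-, hA1, hA2⟩ := Afun_deriv hs' hH
    obtain ⟨-, hw1, hw2⟩ := ω₂_deriv hF' hs' hH hD
    obtain ⟨ho1, ho2⟩ := ω₁_deriv hF' hs' hH hD
    rw [hpp, ← hq] at hD1 hD2 hA1 hA2
    rw [Dω, Matrix.det_fin_two_of, ho1, ho2]
    exact (det_alg p _ _ _ _ _ _ _ _ _ _ _ _ _ _ _ _ _ _ _ _ _ hrp.ne' hD hq hD1 hD2 hA1 hA2
      hw1 hw2).symm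
end
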